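/- Short-maturity expansion of the Black-Scholes put price with perturbed volatility: fix S₀ > 0, σ > 0, z ∈ ℝ, a ∈ ℝ and H ∈ (0,1/2], and set Δ(θ) = (e^{z√θ} − 1)/√θ. Then, as θ → 0⁺, p_BS(S₀, S₀·e^{z√θ}, θ, σ + a·θ^H)/(S₀·√θ) − [ Δ(θ)·Φ(Δ(θ)/σ) + σ·φ(Δ(θ)/σ)·(1 + (z/2)·√θ + (a/σ)·θ^H) ] = o(θ^H). -/

import Mathlib

open MeasureTheory Real Filter

/-- The standard normal density. -/
noncomputable def stdNormalPDF (x : ℝ) : ℝ :=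
  (Real.sqrt (2 * Real.pi))⁻¹ * Real.exp (-(x ^ 2) / 2)

/-- The standard normal cumulative distribution function. -/
noncomputable def stdNormalCDF (x : ℝ) : ℝ :=
  ∫ t in Set.Iic x, stdNormalPDF t

/-- `d₁ = log(S/K)/(σ√θ) + σ√θ/2`. -/
noncomputable def d1 (S K θ σ : ℝ) : ℝ :=
  Real.log (S / K) / (σ * Real.sqrt θ) + σ * Real.sqrt θ / 2

/-- `d₂ = d₁ − σ√θ`. -/
noncomputable def d2 (S K θ σ : ℝ) : ℝ :=
  d1 S K θ σ - σ * Real.sqrt θ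

/-- Black-Scholes call price `c_BS(S,K,θ,σ) = S·Φ(d₁) − K·Φ(d₂)`. -/
noncomputable def cBS (S K θ σ : ℝ) : ℝ :=
  S * stdNormalCDF (d1 S K θ σ) - K * stdNormalCDF (d2 S K θ σ)

/-- Black-Scholes put price `p_BS(S,K,θ,σ) = K·Φ(−d₂) − S·Φ(−d₁)`. -/
noncomputable def pBS (S K θ σ : ℝ) : ℝ :=
  K * stdNormalCDF (-(d2 S K θ σ)) - S * stdNormalCDF (-(d1 S K θ σ))

open Asymptotics Topology

theorem integrable_stdNormalPDF : Integrable stdNormalPDF := by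
  have h := (integrable_exp_neg_mul_sq (b := 1 / 2) (by norm_num)).const_mul
    (Real.sqrt (2 * Real.pi))⁻¹
  refine h.congr (Eventually.of_forall fun x => ?_)
  simp only [stdNormalPDF]
  congr 2
  ring

theorem hasDerivAt_stdNormalPDF (x : ℝ) :
    HasDerivAt stdNormalPDF (-x * stdNormalPDF x) x := by
  have h := ((((hasDerivAt_id x).pow 2).neg.div_const 2).exp).const_mul
    (Real.sqrt (2 * Real.pi))⁻¹
  refine h.congr_deriv ?_
  simp [stdNormalPDF]
  ring

theorem continuous_stdNormalPDF : Continuous stdNormalPDF := by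
  unfold stdNormalPDF
  fun_prop

theorem hasStrictDerivAt_stdNormalPDF (x : ℝ) :
    HasStrictDerivAt stdNormalPDF (-x * stdNormalPDF x) x :=
  hasStrictDerivAt_of_hasDerivAt_of_continuousAt
    (Eventually.of_forall hasDerivAt_stdNormalPDF)
    (continuous_neg.mul continuous_stdNormalPDF).continuousAt

theorem hasDerivAt_stdNormalCDF (x : ℝ) :
    HasDerivAt stdNormalCDF (stdNormalPDF x) x := by
  have h : stdNormalCDF = fun y => (∫ t in (0 : ℝ)..y, stdNormalPDF t) + stdNormalCDF 0 := by
    funext y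
    rw [← intervalIntegral.integral_Iic_sub_Iic integrable_stdNormalPDF.integrableOn
      integrable_stdNormalPDF.integrableOn]
    simp [stdNormalCDF]
  rw [h]
  exact (continuous_stdNormalPDF.integral_hasStrictDerivAt 0 x).hasDerivAt.add_const _

theorem hasStrictDerivAt_stdNormalCDF (x : ℝ) :
    HasStrictDerivAt stdNormalCDF (stdNormalPDF x) x :=
  hasStrictDerivAt_of_hasDerivAt_of_continuousAt
    (Eventually.of_forall hasDerivAt_stdNormalCDF) continuous_stdNormalPDF.continuousAt

/-- A symmetric difference of `F` about a moving centre `m → x₀` agrees with its linear part up to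
second order, as soon as `F' = f` is strictly differentiable at `x₀`. -/
theorem isLittleO_symmetric_difference {ι : Type*} {l : Filter ι} {F f : ℝ → ℝ} {c x₀ : ℝ}
    {m h : ι → ℝ} (hF : ∀ x, HasDerivAt F (f x) x) (hf : HasStrictDerivAt f c x₀)
    (hm : Tendsto m l (𝓝 x₀)) (hh : Tendsto h l (𝓝 0)) :
    (fun i => F (m i + h i) - F (m i - h i) - 2 * h i * f (m i)) =o[l] fun i => h i ^ 2 := by
  rw [isLittleO_iff]
  intro δ hδ
  have hδ2 : 0 < δ / 2 := half_pos hδ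
  obtain ⟨r, hr, hball⟩ := Metric.eventually_nhds_iff.1 (hf.isLittleO.def hδ2)
  filter_upwards [Metric.tendsto_nhds.1 hm (r / 2) (half_pos hr),
    Metric.tendsto_nhds.1 hh (r / 2) (half_pos hr)] with i hmi hhi
  rw [Real.dist_eq] at hmi hhi
  rw [sub_zero] at hhi
  have key : ∀ t, |t| ≤ |h i| → |f (m i + t) - f (m i) - c * t| ≤ δ / 2 * |t| := by
    intro t ht
    have h1 : dist (m i + t, m i) (x₀, x₀) < r := by
      rw [Prod.dist_eq, max_lt_iff, Real.dist_eq, Real.dist_eq]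
      refine ⟨?_, by linarith⟩
      calc |m i + t - x₀| = |(m i - x₀) + t| := by ring_nf
        _ ≤ |m i - x₀| + |t| := abs_add_le _ _
        _ < r := by linarith
    have h2 := hball h1
    simpa [mul_comm] using h2
  have hder : ∀ t ∈ Set.Icc (-|h i|) |h i|,
      HasDerivWithinAt (fun t => F (m i + t) - F (m i - t) - 2 * t * f (m i))
        (f (m i + t) + f (m i - t) - 2 * f (m i)) (Set.Icc (-|h i|) |h i|) t := by
    intro t _
    have h1 := ((hF (m i + t)).comp_const_add (m i) t).sub ((hF (m i - t)).comp_const_sub (m i) t)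
    have h2 := h1.sub (((hasDerivAt_id t).const_mul 2).mul_const (f (m i)))
    refine (h2.congr_deriv ?_).hasDerivWithinAt
    ring
  have hbound : ∀ t ∈ Set.Icc (-|h i|) |h i|,
      ‖f (m i + t) + f (m i - t) - 2 * f (m i)‖ ≤ δ * |h i| := by
    intro t ht
    have ht' : |t| ≤ |h i| := abs_le.2 ht
    have h1 := key t ht'
    have h2 := key (-t) (by rwa [abs_neg])
    rw [abs_neg, ← sub_eq_add_neg] at h2
    calc ‖f (m i + t) + f (m i - t) - 2 * f (m i)‖
        = |(f (m i + t) - f (m i) - c * t) + (f (m i - t) - f (m i) - c * -t)| := by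
          rw [Real.norm_eq_abs]; ring_nf
      _ ≤ δ / 2 * |t| + δ / 2 * |t| := (abs_add_le _ _).trans (add_le_add h1 h2)
      _ = δ * |t| := by ring
      _ ≤ δ * |h i| := by gcongr
  have hmv := (convex_Icc (-|h i|) |h i|).norm_image_sub_le_of_norm_hasDerivWithin_le hder hbound
    (x := 0) (y := h i) (by simp) ⟨neg_abs_le _, le_abs_self _⟩
  simp only [add_zero, sub_zero, sub_self, mul_zero, zero_mul, Real.norm_eq_abs] at hmv
  rw [Real.norm_eq_abs, Real.norm_eq_abs, abs_pow]
  linarith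

theorem isBigO_exp_mul_sub_one_div_sub {ι : Type*} {l : Filter ι} {s : ι → ℝ} (z : ℝ)
    (hs : Tendsto s l (𝓝 0)) (hs0 : ∀ᶠ i in l, s i ≠ 0) :
    (fun i => (Real.exp (z * s i) - 1) / s i - z) =O[l] s := by
  have hzs : Tendsto (fun i => |z * s i|) l (𝓝 0) := by
    simpa using (hs.const_mul z).abs
  refine IsBigO.of_bound (z ^ 2) ?_
  filter_upwards [hs0, hzs.eventually_le_const one_pos] with i hi hi1
  have h := Real.abs_exp_sub_one_sub_id_le hi1
  have hpos : 0 < |s i| := abs_pos.2 hi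
  have heq : (Real.exp (z * s i) - 1) / s i - z = (Real.exp (z * s i) - 1 - z * s i) / s i := by
    field_simp
  rw [heq, Real.norm_eq_abs, Real.norm_eq_abs, abs_div, div_le_iff₀ hpos, mul_assoc,
    abs_mul_abs_self]
  calc _ ≤ _ := h
    _ = _ := by ring

theorem pBS_mul_exp_div {S s v θ z : ℝ} (hS : 0 < S) (hs : 0 < s) (hv : v ≠ 0)
    (hθ : Real.sqrt θ = s) :
    pBS S (S * Real.exp (z * s)) θ v / (S * s) =
      (Real.exp (z * s) - 1) / s * stdNormalCDF (z / v + v * s / 2)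
        + (stdNormalCDF (z / v + v * s / 2) - stdNormalCDF (z / v - v * s / 2)) / s := by
  have hd1 : d1 S (S * Real.exp (z * s)) θ v = -(z / v - v * s / 2) := by
    have : S / (S * Real.exp (z * s)) = Real.exp (-(z * s)) := by
      rw [Real.exp_neg]; field_simp
    rw [d1, this, Real.log_exp, hθ]
    field_simp
    ring
  have hd2 : d2 S (S * Real.exp (z * s)) θ v = -(z / v + v * s / 2) := by
    rw [d2, hd1, hθ]; ring
  rw [pBS, hd1, hd2, neg_neg, neg_neg]
  field_simp
  ring

/-- The expansion in terms of independent small parameters: `s` plays the role of `√θ` and `e` that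
of `θ ^ H`. -/
theorem isLittleO_put_expansion {ι : Type*} {l : Filter ι} {s e D : ι → ℝ} {σ z a : ℝ}
    (hσ : 0 < σ) (he : Tendsto e l (𝓝 0)) (hs0 : ∀ᶠ i in l, s i ≠ 0)
    (hse : s =O[l] e) (hD : (fun i => D i - z) =O[l] e) :
    (fun i => D i * stdNormalCDF (z / (σ + a * e i) + (σ + a * e i) * s i / 2)
        + (stdNormalCDF (z / (σ + a * e i) + (σ + a * e i) * s i / 2)
          - stdNormalCDF (z / (σ + a * e i) - (σ + a * e i) * s i / 2)) / s i
        - (D i * stdNormalCDF (D i / σ)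
          + σ * stdNormalPDF (D i / σ) * (1 + z / 2 * s i + a / σ * e i))) =o[l] e := by
  have hs : Tendsto s l (𝓝 0) := hse.trans_tendsto he
  have hDz : Tendsto D l (𝓝 z) := tendsto_sub_nhds_zero_iff.1 (hD.trans_tendsto he)
  have hv : Tendsto (fun i => σ + a * e i) l (𝓝 σ) := by
    simpa using (he.const_mul a).const_add σ
  have hm : Tendsto (fun i => z / (σ + a * e i)) l (𝓝 (z / σ)) := tendsto_const_nhds.div hv hσ.ne'
  have hh : Tendsto (fun i => (σ + a * e i) * s i / 2) l (𝓝 0) := by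
    simpa using (hv.mul hs).div_const 2
  have hy : Tendsto (fun i => D i / σ) l (𝓝 (z / σ)) := hDz.div_const σ
  have hu : Tendsto (fun i => z / (σ + a * e i) + (σ + a * e i) * s i / 2) l (𝓝 (z / σ)) := by
    simpa using hm.add hh
  have hv0 : ∀ᶠ i in l, σ + a * e i ≠ 0 := hv.eventually_ne hσ.ne'
  have hM : (fun i => z / (σ + a * e i) - z / σ) =O[l] e := by
    have h1 : Tendsto (fun i => -(z * a) / ((σ + a * e i) * σ)) l (𝓝 (-(z * a) / (σ * σ))) :=
      tendsto_const_nhds.div (hv.mul_const σ) (mul_pos hσ hσ).ne'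
    have h2 := (h1.isBigO_one ℝ).mul (isBigO_refl e l)
    simp only [one_mul] at h2
    refine h2.congr' ?_ EventuallyEq.rfl
    filter_upwards [hv0] with i hi
    field_simp
    ring
  have hy' : (fun i => D i / σ - z / σ) =O[l] e := by
    simpa [div_eq_inv_mul, mul_sub] using hD.const_mul_left σ⁻¹
  have hh' : (fun i => (σ + a * e i) * s i / 2) =O[l] s := by
    simpa [div_eq_mul_inv, mul_right_comm] using
      ((hv.mul_const (2 : ℝ)⁻¹).isBigO_one ℝ).mul (isBigO_refl s l)
  have huy : (fun i => z / (σ + a * e i) + (σ + a * e i) * s i / 2 - D i / σ) =O[l] e := by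
    refine ((hM.add (hh'.trans hse)).sub hy').congr_left fun i => ?_
    ring
  have hR1 : (fun i => stdNormalCDF (z / (σ + a * e i) + (σ + a * e i) * s i / 2)
      - stdNormalCDF (D i / σ)
      - stdNormalPDF (z / σ) * (z / (σ + a * e i) + (σ + a * e i) * s i / 2 - D i / σ)) =o[l] e := by
    have h := (hasStrictDerivAt_stdNormalCDF (z / σ)).isLittleO.comp_tendsto (hu.prodMk_nhds hy)
    refine (h.trans_isBigO huy).congr_left fun i => ?_
    simp [mul_comm]
  have hR2 : (fun i => (stdNormalCDF (z / (σ + a * e i) + (σ + a * e i) * s i / 2)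
      - stdNormalCDF (z / (σ + a * e i) - (σ + a * e i) * s i / 2)
      - 2 * ((σ + a * e i) * s i / 2) * stdNormalPDF (z / (σ + a * e i))) / s i) =o[l] e := by
    have h := (isLittleO_symmetric_difference hasDerivAt_stdNormalCDF
      (hasStrictDerivAt_stdNormalPDF (z / σ)) hm hh).trans_isBigO (hh'.pow 2)
    have h' := h.mul_isBigO (isBigO_refl (fun i => (s i)⁻¹) l)
    refine IsLittleO.trans_isBigO (h'.congr' ?_ ?_) hse
    · exact Eventually.of_forall fun i => (div_eq_mul_inv _ _).symm
    · filter_upwards [hs0] with i hi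
      field_simp
  have hR (x : ι → ℝ) (hx : Tendsto x l (𝓝 (z / σ))) (hxe : (fun i => x i - z / σ) =O[l] e) :
      (fun i => stdNormalPDF (x i) - stdNormalPDF (z / σ)
        + z / σ * stdNormalPDF (z / σ) * (x i - z / σ)) =o[l] e := by
    have h := (hasDerivAt_stdNormalPDF (z / σ)).isLittleO.comp_tendsto hx
    refine (h.trans_isBigO hxe).congr_left fun i => ?_
    simp
    ring
  have hR3 := hR _ hm hM
  have hR4 := hR _ hy hy'
  have hw : Tendsto (fun i => σ + σ * z / 2 * s i + a * e i) l (𝓝 σ) := by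
    simpa using ((hs.const_mul (σ * z / 2)).const_add σ).add (he.const_mul a)
  have mulO {g r : ι → ℝ} {b : ℝ} (hg : Tendsto g l (𝓝 b)) (hr : r =o[l] e) :
      (fun i => g i * r i) =o[l] e := by
    simpa using (hg.isBigO_one ℝ).mul_isLittleO hr
  have mulo {g r : ι → ℝ} (hg : Tendsto g l (𝓝 0)) (hr : r =O[l] e) :
      (fun i => g i * r i) =o[l] e := by
    simpa using ((isLittleO_one_iff ℝ).2 hg).mul_isBigO hr
  have hD0 : Tendsto (fun i => D i - z) l (𝓝 0) := hD.trans_tendsto he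
  have hq : Tendsto (fun i => a * (z / 2 * s i - z / σ * (z / (σ + a * e i) - z / σ))) l (𝓝 0) := by
    simpa using ((hs.const_mul (z / 2)).sub
      ((hM.trans_tendsto he).const_mul (z / σ))).const_mul a
  have hp : Tendsto (fun i => (σ * z / 2 * s i + a * e i) * (z / σ / σ)) l (𝓝 0) := by
    simpa using ((hs.const_mul (σ * z / 2)).add (he.const_mul a)).mul_const (z / σ / σ)
  have htotal := ((((mulO hDz hR1).add hR2).add (mulO hv hR3)).sub (mulO hw hR4)).add
    ((((mulo hD0 huy).add (mulo hq (isBigO_refl e l))).add (mulo hp hD)).const_mul_left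
      (stdNormalPDF (z / σ)))
  refine htotal.congr' ?_ EventuallyEq.rfl
  filter_upwards [hs0, hv0] with i hsi hvi
  generalize stdNormalCDF (z / (σ + a * e i) + (σ + a * e i) * s i / 2) = Fu
  generalize stdNormalCDF (z / (σ + a * e i) - (σ + a * e i) * s i / 2) = Fw
  generalize stdNormalCDF (D i / σ) = Fy
  generalize stdNormalPDF (D i / σ) = fy
  generalize stdNormalPDF (z / (σ + a * e i)) = fm
  generalize stdNormalPDF (z / σ) = f₀
  generalize z / (σ + a * e i) = m
  field_simp
  ring

/-- Short-maturity expansion of the Black-Scholes put price with perturbed volatility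
`σ + a·θ^H`: with `Δ(θ) = (e^{z√θ} − 1)/√θ`, as `θ → 0⁺`,
`p_BS(S₀, S₀e^{z√θ}, θ, σ + aθ^H)/(S₀√θ)
  − [Δ(θ)Φ(Δ(θ)/σ) + σφ(Δ(θ)/σ)(1 + (z/2)√θ + (a/σ)θ^H)] = o(θ^H)`. -/
theorem blackScholes_put_perturbed_vol_expansion
    (S₀ σ : ℝ) (hS₀ : 0 < S₀) (hσ : 0 < σ) (z a : ℝ)
    (H : ℝ) (hH : H ∈ Set.Ioc (0:ℝ) (1/2)) :
    (fun θ : ℝ =>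
        pBS S₀ (S₀ * Real.exp (z * Real.sqrt θ)) θ (σ + a * θ ^ H) / (S₀ * Real.sqrt θ)
          - ((Real.exp (z * Real.sqrt θ) - 1) / Real.sqrt θ
                * stdNormalCDF ((Real.exp (z * Real.sqrt θ) - 1) / Real.sqrt θ / σ)
              + σ * stdNormalPDF ((Real.exp (z * Real.sqrt θ) - 1) / Real.sqrt θ / σ)
                * (1 + z / 2 * Real.sqrt θ + a / σ * θ ^ H)))
      =o[nhdsWithin 0 (Set.Ioi 0)] fun θ : ℝ => θ ^ H := by
  have hpos : ∀ᶠ θ : ℝ in 𝓝[>] 0, 0 < θ := self_mem_nhdsWithin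
  have he : Tendsto (fun θ : ℝ => θ ^ H) (𝓝[>] 0) (𝓝 0) := by
    have h := (Real.continuousAt_rpow_const 0 H (Or.inr hH.1.le)).tendsto
    rw [Real.zero_rpow hH.1.ne'] at h
    exact h.mono_left nhdsWithin_le_nhds
  have hse : Real.sqrt =O[𝓝[>] 0] fun θ : ℝ => θ ^ H := by
    refine IsBigO.of_bound 1 ?_
    filter_upwards [hpos, (eventually_le_nhds one_pos).filter_mono nhdsWithin_le_nhds] with θ h0 h1
    rw [one_mul, Real.norm_of_nonneg (Real.sqrt_nonneg θ),
      Real.norm_of_nonneg (Real.rpow_nonneg h0.le H), Real.sqrt_eq_rpow]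
    exact Real.rpow_le_rpow_of_exponent_ge h0 h1 hH.2
  have hs0 : ∀ᶠ θ : ℝ in 𝓝[>] 0, Real.sqrt θ ≠ 0 := by
    filter_upwards [hpos] with θ h0 using (Real.sqrt_pos.2 h0).ne'
  have hD := (isBigO_exp_mul_sub_one_div_sub z (hse.trans_tendsto he) hs0).trans hse
  have hv : Tendsto (fun θ : ℝ => σ + a * θ ^ H) (𝓝[>] 0) (𝓝 σ) := by
    simpa using (he.const_mul a).const_add σ
  refine (isLittleO_put_expansion (a := a) hσ he hs0 hse hD).congr' ?_ EventuallyEq.rfl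
  filter_upwards [hpos, hv.eventually_ne hσ.ne'] with θ h0 hvθ
  rw [pBS_mul_exp_div hS₀ (Real.sqrt_pos.2 h0) hvθ rfl]
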